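/- arXiv:2305.19651 — 2 statements merged into one kernel-verified Lean document; each statement's English description precedes it below -/
import Mathlib

section
/- Every real Dirichlet character χ modulo N can be written in the form χ(y) = (d/y) (extended Kronecker symbol) for some integer d with d ≡ 0 or 1 mod 4; moreover, every primitive real character modulo N equals (D/·) for a fundamental discriminant D with |D| equal to the conductor of χ. -/
/-- The Kronecker symbol `(a/2)`, given by `χ₈`. -/
def kron2 (a : ℤ) : ℤ := ZMod.χ₈ (a : ZMod 8)

/-- The extended Kronecker symbol `(a/n)` for `n : ℕ`: multiplicative in `n`,
equal to the Jacobi symbol on the odd part of `n` and to `χ₈(a)` at `2`;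
for `n = 0` it is `1` if `a = ±1` and `0` otherwise. -/
def kron (a : ℤ) (n : ℕ) : ℤ :=
  if n = 0 then (if a = 1 ∨ a = -1 then 1 else 0)
  else (kron2 a) ^ (n.factorization 2) * jacobiSym a (n / 2 ^ (n.factorization 2))

/-- A fundamental discriminant: a squarefree integer `≡ 1 (mod 4)`, or `4` times a
squarefree integer `≡ 2` or `3 (mod 4)`. -/
def IsFundamentalDiscriminant (D : ℤ) : Prop :=
  (D % 4 = 1 ∧ Squarefree D) ∨
  (D % 4 = 0 ∧ Squarefree (D / 4) ∧ ((D / 4) % 4 = 2 ∨ (D / 4) % 4 = 3))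

theorem kron_mul_left (a b : ℤ) (n : ℕ) : kron (a * b) n = kron a n * kron b n := by
  unfold kron
  split_ifs with h h1 h2 h3 h3 h2 h3
  all_goals try simp_all [Int.mul_eq_one_iff_eq_one_or_neg_one,
    Int.mul_eq_neg_one_iff_eq_one_or_neg_one]
  all_goals try omega
  rw [jacobiSym.mul_left, show kron2 (a * b) = kron2 a * kron2 b by
    simp only [kron2, Int.cast_mul, map_mul], mul_pow]
  ring

theorem kron2_eq_zero_of_even {a : ℤ} (h : Even a) : kron2 a = 0 := by
  rw [kron2, ZMod.χ₈_int_eq_if_mod_eight, if_pos (Int.even_iff.mp h)]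

theorem kron2_sq_eq_one_of_odd {a : ℤ} (h : Odd a) : kron2 a ^ 2 = 1 := by
  rw [kron2, ZMod.χ₈_int_eq_if_mod_eight, if_neg (by rw [Int.odd_iff] at h; omega)]
  split_ifs <;> rfl

theorem kron_sq_eq_one {a : ℤ} {n : ℕ} (h : IsCoprime a n) : kron a n ^ 2 = 1 := by
  unfold kron
  split_ifs with h0 h1
  · rfl
  · subst h0
    rw [Nat.cast_zero, isCoprime_zero_right, Int.isUnit_iff] at h
    exact absurd h h1
  · have hJ : jacobiSym a (n / 2 ^ n.factorization 2) ^ 2 = 1 := by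
      apply jacobiSym.sq_one
      rw [← Int.isCoprime_iff_gcd_eq_one]
      exact h.of_isCoprime_of_dvd_right (Int.natCast_dvd_natCast.mpr (Nat.ordCompl_dvd n 2))
    rw [mul_pow, hJ, mul_one, ← pow_mul, mul_comm, pow_mul]
    by_cases h2 : 2 ∣ n
    · have ha : Odd a := by
        rw [← Int.not_even_iff_odd, even_iff_two_dvd]
        intro ha
        have := h.isUnit_of_dvd' ha (by exact_mod_cast h2)
        simp [Int.isUnit_iff] at this
      rw [kron2_sq_eq_one_of_odd ha, one_pow]
    · rw [Nat.factorization_eq_zero_of_not_dvd h2, pow_zero]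

theorem kron_eq_zero {a : ℤ} {n : ℕ} (h : ¬ IsCoprime a n) : kron a n = 0 := by
  unfold kron
  split_ifs with h0 h1
  · subst h0
    rw [Nat.cast_zero, isCoprime_zero_right, Int.isUnit_iff] at h
    exact absurd h1 h
  · rfl
  · rw [Int.isCoprime_iff_gcd_eq_one, Nat.eq_one_iff_not_exists_prime_dvd] at h
    push Not at h
    obtain ⟨p, hp, hpd⟩ := h
    have hpa : (p : ℤ) ∣ a := (Int.natCast_dvd_natCast.mpr hpd).trans (Int.gcd_dvd_left ..)
    have hpn : p ∣ n :=
      Int.natCast_dvd_natCast.mp ((Int.natCast_dvd_natCast.mpr hpd).trans (Int.gcd_dvd_right ..))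
    rcases eq_or_ne p 2 with rfl | hp2
    · rw [kron2_eq_zero_of_even (even_iff_two_dvd.mpr (by exact_mod_cast hpa)), zero_pow, zero_mul]
      exact (hp.factorization_pos_of_dvd h0 hpn).ne'
    · have hpm : p ∣ n / 2 ^ n.factorization 2 := by
        refine Nat.Coprime.dvd_of_dvd_mul_left (m := 2 ^ n.factorization 2) ?_ ?_
        · exact Nat.Coprime.pow_right _ ((Nat.coprime_primes hp Nat.prime_two).mpr hp2)
        · rwa [Nat.ordProj_mul_ordCompl_eq_self]
      rw [jacobiSym.eq_zero_iff.mpr, mul_zero]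
      refine ⟨(Nat.ordCompl_pos 2 h0).ne', fun hg ↦ hp.one_lt.ne' ?_⟩
      exact Nat.dvd_one.mp (hg ▸ Int.dvd_gcd hpa (Int.natCast_dvd_natCast.mpr hpm))

theorem kron2_eq_jacobiSym_two {a : ℤ} (h : a % 4 = 1) : kron2 a = jacobiSym 2 a.natAbs := by
  rw [jacobiSym.at_two (by rw [Nat.odd_iff]; omega), ZMod.χ₈_nat_eq_if_mod_eight, kron2,
    ZMod.χ₈_int_eq_if_mod_eight]
  split_ifs <;> first | rfl | omega

theorem jacobiSym_eq_jacobiSym_natAbs {a : ℤ} (h : a % 4 = 1) {b : ℕ} (hb : Odd b) :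
    jacobiSym a b = jacobiSym b a.natAbs := by
  obtain ⟨n, rfl | rfl⟩ := a.eq_nat_or_neg
  · rw [Int.natAbs_natCast]
    exact jacobiSym.quadratic_reciprocity_one_mod_four (by omega) hb
  · rw [Int.natAbs_neg, Int.natAbs_natCast, jacobiSym.neg _ hb]
    rcases Nat.odd_mod_four_iff.mp (Nat.odd_iff.mp hb) with h4 | h4
    · rw [ZMod.χ₄_nat_one_mod_four h4, one_mul]
      exact jacobiSym.quadratic_reciprocity_one_mod_four' (by rw [Nat.odd_iff]; omega) h4
    · rw [ZMod.χ₄_nat_three_mod_four h4,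
        jacobiSym.quadratic_reciprocity_three_mod_four (by omega) h4]
      ring

theorem kron_eq_jacobiSym {a : ℤ} (h : a % 4 = 1) (n : ℕ) :
    kron a n = jacobiSym n a.natAbs := by
  unfold kron
  split_ifs with h0 h1
  · subst h0
    rcases h1 with rfl | rfl <;> simp
  · subst h0
    simp only [Nat.cast_zero]
    rw [jacobiSym.zero_left (by omega)]
  · rw [jacobiSym_eq_jacobiSym_natAbs h, kron2_eq_jacobiSym_two h, ← jacobiSym.pow_left,
      ← jacobiSym.mul_left]
    · congr 1
      exact_mod_cast Nat.ordProj_mul_ordCompl_eq_self n 2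
    · have := Nat.not_dvd_ordCompl Nat.prime_two h0
      rw [Nat.odd_iff]; omega

theorem kron_of_odd (a : ℤ) {n : ℕ} (h : Odd n) : kron a n = jacobiSym a n := by
  have h0 : n ≠ 0 := by rintro rfl; simp at h
  have h2 : n.factorization 2 = 0 :=
    Nat.factorization_eq_zero_of_not_dvd (by rw [Nat.odd_iff] at h; omega)
  simp [kron, h0, h2]

theorem kron_eq_one_of_modEq {a : ℤ} (h0 : a ≠ 0) (h : a % 4 = 0 ∨ a % 4 = 1) {n : ℕ}
    (hn : (n : ℤ) ≡ 1 [ZMOD a]) : kron a n = 1 := by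
  rcases h with h | h
  · obtain ⟨m, rfl⟩ := Int.dvd_of_emod_eq_zero h
    have hodd : Odd n := by
      have := (hn.of_mul_right m).of_mul_right (m := 2) (n := 2)
      rw [Nat.odd_iff]
      simp only [Int.ModEq] at this
      omega
    have hn' : n ≡ 1 [MOD 4 * m.natAbs] := by
      rw [← Int.natCast_modEq_iff, Int.modEq_iff_dvd]
      simpa [Int.natAbs_mul] using Int.natAbs_dvd.mpr hn.dvd
    rw [kron_of_odd _ hodd, jacobiSym.mul_left, jacobiSym.at_four hodd, one_mul,
      jacobiSym.mod_right _ hodd, hn', Nat.mod_eq_of_lt (by omega), jacobiSym.one_right]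
  · rw [kron_eq_jacobiSym h, jacobiSym.mod_left' (a₂ := 1), jacobiSym.one_left]
    simpa [Int.ModEq] using hn

theorem IsFundamentalDiscriminant.emod_four {D : ℤ} (h : IsFundamentalDiscriminant D) :
    D % 4 = 0 ∨ D % 4 = 1 :=
  h.elim (fun h ↦ Or.inr h.1) (fun h ↦ Or.inl h.1)

theorem IsFundamentalDiscriminant.ne_zero {D : ℤ} (h : IsFundamentalDiscriminant D) : D ≠ 0 := by
  rintro rfl
  rcases h with h | h <;> simp at h

theorem isFundamentalDiscriminant_one : IsFundamentalDiscriminant 1 :=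
  Or.inl ⟨rfl, squarefree_one⟩

theorem IsFundamentalDiscriminant.mul {D E : ℤ} (hD : IsFundamentalDiscriminant D)
    (hE : IsFundamentalDiscriminant E) (h : IsCoprime D E) :
    IsFundamentalDiscriminant (D * E) := by
  have key : ∀ {D m : ℤ}, D % 4 = 1 → Squarefree D → Squarefree m → (m % 4 = 2 ∨ m % 4 = 3) →
      IsCoprime D (4 * m) → IsFundamentalDiscriminant (4 * (D * m)) := by
    intro D m h1 hs hm h4 hc
    refine Or.inr ⟨by simp, ?_, ?_⟩ <;> rw [Int.mul_ediv_cancel_left _ (by norm_num)]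
    · exact squarefree_mul_iff.mpr ⟨hc.of_mul_right_right.isRelPrime, hs, hm⟩
    · rw [Int.mul_emod, h1]
      omega
  rcases hD with ⟨h1, hs⟩ | ⟨h1, hs, h4⟩ <;> rcases hE with ⟨h1', hs'⟩ | ⟨h1', hs', h4'⟩
  · exact Or.inl ⟨by rw [Int.mul_emod, h1, h1']; rfl,
      squarefree_mul_iff.mpr ⟨h.isRelPrime, hs, hs'⟩⟩
  · obtain ⟨m, rfl⟩ := Int.dvd_of_emod_eq_zero h1'
    rw [Int.mul_ediv_cancel_left _ (by norm_num)] at hs' h4'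
    rw [mul_left_comm]
    exact key h1 hs hs' h4' h
  · obtain ⟨m, rfl⟩ := Int.dvd_of_emod_eq_zero h1
    rw [Int.mul_ediv_cancel_left _ (by norm_num)] at hs h4
    rw [mul_assoc, mul_comm m]
    exact key h1' hs' hs h4 h.symm
  · have := h.isUnit_of_dvd' (Int.dvd_of_emod_eq_zero h1) (Int.dvd_of_emod_eq_zero h1')
    simp [Int.isUnit_iff] at this

theorem ZMod.val_modEq_one_of_unitsMap_eq_one {M N : ℕ} [NeZero N] (h : M ∣ N) {u : (ZMod N)ˣ}
    (hu : ZMod.unitsMap h u = 1) : u.val.val ≡ 1 [MOD M] := by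
  have := congrArg Units.val hu
  rwa [ZMod.unitsMap_val, ZMod.cast_eq_val, Units.val_one, ← Nat.cast_one (R := ZMod M),
    ZMod.natCast_eq_natCast_iff] at this

theorem ZMod.odd_of_natCast_eq_unit {N : ℕ} (h : 2 ∣ N) {u : (ZMod N)ˣ} {y : ℕ}
    (hy : (y : ZMod N) = u) : Odd y :=
  (((ZMod.isUnit_iff_coprime y N).mp (hy ▸ u.isUnit)).coprime_dvd_right h).odd_of_right

theorem MonoidHom.eq_one_of_isSquare_val {M : Type*} [CommMonoid M] (χ : Mˣ →* ℤˣ) {u : Mˣ}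
    (h : IsSquare (u : M)) : χ u = 1 := by
  obtain ⟨x, hx⟩ := h
  have hxu : IsUnit x := isUnit_of_mul_isUnit_left (y := x) (hx ▸ u.isUnit)
  obtain ⟨v, rfl⟩ := hxu
  rw [show u = v * v from Units.ext hx, map_mul, Int.units_mul_self]

/-- The units character `χ` is given by `kron D` for a fundamental discriminant `D ∣ N`. -/
def IsKroneckerChar {N : ℕ} (χ : (ZMod N)ˣ →* ℤˣ) : Prop :=
  ∃ D : ℤ, IsFundamentalDiscriminant D ∧ D ∣ N ∧
    ∀ (u : (ZMod N)ˣ) (y : ℕ), (y : ZMod N) = u → kron D y = χ u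

theorem kron_one (n : ℕ) : kron 1 n = 1 := by
  rw [kron_eq_jacobiSym rfl, Int.natAbs_one, jacobiSym.one_right]

theorem isKroneckerChar_one {N : ℕ} : IsKroneckerChar (1 : (ZMod N)ˣ →* ℤˣ) :=
  ⟨1, isFundamentalDiscriminant_one, one_dvd _, fun _ y _ ↦ by simp [kron_one]⟩

theorem IsKroneckerChar.comp_unitsMap {M N : ℕ} (h : M ∣ N) {χ : (ZMod M)ˣ →* ℤˣ}
    (hχ : IsKroneckerChar χ) : IsKroneckerChar (χ.comp (ZMod.unitsMap h)) := by
  obtain ⟨D, hD, hDM, hy⟩ := hχ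
  refine ⟨D, hD, hDM.trans (Int.natCast_dvd_natCast.mpr h), fun u y hu ↦ hy _ y ?_⟩
  rw [ZMod.unitsMap_val, ← hu, ZMod.cast_natCast h]

theorem isKroneckerChar_of_ker_le {M N : ℕ} [NeZero N] (h : M ∣ N)
    (hM : ∀ ψ : (ZMod M)ˣ →* ℤˣ, IsKroneckerChar ψ) (χ : (ZMod N)ˣ →* ℤˣ)
    (hker : (ZMod.unitsMap h).ker ≤ χ.ker) : IsKroneckerChar χ := by
  let E := MonoidHom.liftOfSurjective _ (ZMod.unitsMap_surjective h) ⟨_, hker⟩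
  have hE : E.comp (ZMod.unitsMap h) = χ := MonoidHom.liftOfRightInverse_comp ..
  rw [← hE]
  exact (hM E).comp_unitsMap h

theorem isKroneckerChar_prime {p : ℕ} [Fact p.Prime] (hp : p ≠ 2) (χ : (ZMod p)ˣ →* ℤˣ) :
    IsKroneckerChar χ := by
  have hp2 : p % 2 = 1 := (Nat.Prime.eq_two_or_odd Fact.out).resolve_left hp
  have hsq {u : (ZMod p)ˣ} {y : ℕ} (hu : (y : ZMod p) = u) (hy : legendreSym p y = 1) :
      χ u = 1 := by
    apply MonoidHom.eq_one_of_isSquare_val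
    rw [← hu]
    have := (legendreSym.eq_one_iff p (a := y) (by simp [hu])).mp hy
    exact_mod_cast this
  by_cases h1 : χ = 1
  · exact h1 ▸ isKroneckerChar_one
  obtain ⟨v, hv⟩ : ∃ v, χ v ≠ 1 := by
    by_contra! h
    exact h1 (MonoidHom.ext h)
  have hv' : χ v = -1 := (Int.units_eq_one_or _).resolve_left hv
  have hvy : legendreSym p (v.val.val : ℕ) = -1 :=
    (legendreSym.eq_one_or_neg_one p (by simp)).resolve_left (fun h ↦ hv (hsq (by simp) h))
  obtain ⟨D, hD4, hDp⟩ : ∃ D : ℤ, D % 4 = 1 ∧ D.natAbs = p := by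
    rcases Nat.odd_mod_four_iff.mp hp2 with h | h
    · exact ⟨p, by omega, by simp⟩
    · exact ⟨-p, by omega, by simp⟩
  have hps : Squarefree p := (Fact.out : p.Prime).prime.squarefree
  refine ⟨D, Or.inl ⟨hD4, ?_⟩, ?_, fun u y hu ↦ ?_⟩
  · rwa [← Int.squarefree_natAbs, hDp]
  · rw [← Int.natAbs_dvd, hDp]
  · rw [kron_eq_jacobiSym hD4, hDp, ← jacobiSym.legendreSym.to_jacobiSym]
    rcases legendreSym.eq_one_or_neg_one p (a := y) (by simp [hu]) with h | h
    · rw [h, hsq hu h, Units.val_one]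
    · have : χ (u * v) = 1 := by
        refine hsq (y := y * v.val.val) (by simp [hu]) ?_
        rw [Nat.cast_mul, legendreSym.mul, h, hvy]
        rfl
      rw [map_mul, hv'] at this
      rw [h, show χ u = -1 by simpa [neg_eq_iff_eq_neg] using this]
      rfl

theorem isKroneckerChar_odd_prime_pow {p : ℕ} (hp : p.Prime) (hp2 : p ≠ 2) (k : ℕ)
    (χ : (ZMod (p ^ (k + 1)))ˣ →* ℤˣ) : IsKroneckerChar χ := by
  have := Fact.mk hp
  have : NeZero (p ^ (k + 1)) := ⟨pow_ne_zero _ hp.ne_zero⟩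
  refine isKroneckerChar_of_ker_le (dvd_pow_self p k.succ_ne_zero) (isKroneckerChar_prime hp2) χ ?_
  intro u hu
  rw [MonoidHom.mem_ker] at hu ⊢
  have hu1 : ((u.val.val : ℤ) : ZMod p) = ((1 : ℤ) : ZMod p) := by
    have := (ZMod.natCast_eq_natCast_iff _ _ _).mpr (ZMod.val_modEq_one_of_unitsMap_eq_one _ hu)
    exact_mod_cast this
  have hpow : u ^ p ^ k = 1 := by
    ext
    have h := dvd_sub_pow_of_dvd_sub (p := p)
      ((ZMod.intCast_eq_intCast_iff_dvd_sub _ _ _).mp hu1.symm) k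
    rw [one_pow, ← Nat.cast_pow, ← ZMod.intCast_eq_intCast_iff_dvd_sub] at h
    simpa using h.symm
  have hodd : p ^ k % 2 = 1 := Nat.odd_iff.mp ((hp.odd_of_ne_two hp2).pow)
  have := congrArg χ hpow
  rwa [map_pow, Int.units_pow_eq_pow_mod_two, hodd, pow_one, map_one] at this

theorem isFundamentalDiscriminant_neg_four : IsFundamentalDiscriminant (-4) :=
  Or.inr ⟨rfl, by norm_num, by norm_num⟩

theorem isFundamentalDiscriminant_eight : IsFundamentalDiscriminant 8 :=
  Or.inr ⟨rfl, Int.prime_two.squarefree, by norm_num⟩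

theorem isFundamentalDiscriminant_neg_eight : IsFundamentalDiscriminant (-8) :=
  Or.inr ⟨rfl, Int.prime_two.neg.squarefree, by norm_num⟩

theorem kron_neg_four {n : ℕ} (h : Odd n) : kron (-4) n = ZMod.χ₄ n := by
  rw [kron_of_odd _ h, jacobiSym.neg _ h, jacobiSym.at_four h, mul_one]

theorem kron_eight {n : ℕ} (h : Odd n) : kron 8 n = ZMod.χ₈ n := by
  rw [kron_of_odd _ h, show (8 : ℤ) = 4 * 2 by norm_num, jacobiSym.mul_left, jacobiSym.at_four h,
    one_mul, jacobiSym.at_two h]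

theorem kron_neg_eight {n : ℕ} (h : Odd n) : kron (-8) n = ZMod.χ₈' n := by
  rw [kron_of_odd _ h, show (-8 : ℤ) = 4 * (-2) by norm_num, jacobiSym.mul_left,
    jacobiSym.at_four h, one_mul, jacobiSym.at_neg_two h]

theorem isKroneckerChar_two (χ : (ZMod 2)ˣ →* ℤˣ) : IsKroneckerChar χ := by
  have : χ = 1 := by
    ext u
    rw [show u = 1 by decide +revert, map_one, MonoidHom.one_apply]
  exact this ▸ isKroneckerChar_one

theorem isKroneckerChar_four (χ : (ZMod 4)ˣ →* ℤˣ) : IsKroneckerChar χ := by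
  have hu (u : (ZMod 4)ˣ) : u = 1 ∨ u = -1 := by decide +revert
  rcases Int.units_eq_one_or (χ (-1)) with h | h
  · have : χ = 1 := by
      ext u
      rcases hu u with rfl | rfl <;> simp [h]
    exact this ▸ isKroneckerChar_one
  · refine ⟨-4, isFundamentalDiscriminant_neg_four, by norm_num, fun u y hy ↦ ?_⟩
    rw [kron_neg_four (ZMod.odd_of_natCast_eq_unit (by norm_num) hy), hy]
    rcases hu u with rfl | rfl
    · simp
    · rw [h]; rfl

theorem isKroneckerChar_eight (χ : (ZMod 8)ˣ →* ℤˣ) : IsKroneckerChar χ := by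
  let a : (ZMod 8)ˣ := ⟨3, 3, rfl, rfl⟩
  let b : (ZMod 8)ˣ := ⟨5, 5, rfl, rfl⟩
  have hu (u : (ZMod 8)ˣ) : u = 1 ∨ u = a ∨ u = b ∨ u = a * b := by decide +revert
  have hodd {u : (ZMod 8)ˣ} {y : ℕ} (hy : (y : ZMod 8) = u) : Odd y :=
    ZMod.odd_of_natCast_eq_unit (by norm_num) hy
  rcases Int.units_eq_one_or (χ a) with ha | ha <;> rcases Int.units_eq_one_or (χ b) with hb | hb
  · have : χ = 1 := by
      ext u
      rcases hu u with rfl | rfl | rfl | rfl <;> simp [ha, hb]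
    exact this ▸ isKroneckerChar_one
  · refine ⟨-8, isFundamentalDiscriminant_neg_eight, by norm_num, fun u y hy ↦ ?_⟩
    rw [kron_neg_eight (hodd hy), hy]
    rcases hu u with rfl | rfl | rfl | rfl <;> simp only [map_one, map_mul, ha, hb] <;> rfl
  · refine ⟨-4, isFundamentalDiscriminant_neg_four, by norm_num, fun u y hy ↦ ?_⟩
    rw [kron_neg_four (hodd hy), ← ZMod.cast_natCast (by norm_num : 4 ∣ 8), hy]
    have hχ₄ (z : ZMod 8) : ZMod.χ₄ z.cast = ZMod.χ₈ z * ZMod.χ₈' z := by decide +revert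
    rw [hχ₄]
    rcases hu u with rfl | rfl | rfl | rfl <;> simp only [map_one, map_mul, ha, hb] <;> rfl
  · refine ⟨8, isFundamentalDiscriminant_eight, by norm_num, fun u y hy ↦ ?_⟩
    rw [kron_eight (hodd hy), hy]
    rcases hu u with rfl | rfl | rfl | rfl <;> simp only [map_one, map_mul, ha, hb] <;> rfl

theorem Int.exists_two_pow_dvd_sq_sub {a : ℤ} (ha : a % 8 = 1) (k : ℕ) :
    ∃ x : ℤ, 2 ^ (k + 3) ∣ x ^ 2 - a := by
  suffices ∃ x : ℤ, x % 2 = 1 ∧ 2 ^ (k + 3) ∣ x ^ 2 - a from this.imp fun _ h ↦ h.2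
  induction k with
  | zero => exact ⟨1, rfl, by norm_num; omega⟩
  | succ k ih =>
    obtain ⟨x, hx, c, hc⟩ := ih
    rcases Int.emod_two_eq_zero_or_one c with h | h
    · obtain ⟨d, rfl⟩ := Int.dvd_of_emod_eq_zero h
      exact ⟨x, hx, d, by rw [hc]; ring⟩
    · obtain ⟨d, hd⟩ : (2 : ℤ) ∣ c + x := by omega
      refine ⟨x + 2 ^ (k + 2), by rw [pow_succ]; omega, d + 2 ^ k, ?_⟩
      linear_combination hc + 2 ^ (k + 3) * hd

theorem isKroneckerChar_two_pow (k : ℕ) (χ : (ZMod (2 ^ (k + 1)))ˣ →* ℤˣ) : IsKroneckerChar χ := by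
  match k with
  | 0 => exact isKroneckerChar_two χ
  | 1 => exact isKroneckerChar_four χ
  | k + 2 =>
    have h8 : 8 ∣ 2 ^ (k + 2 + 1) := pow_dvd_pow 2 (by omega : 3 ≤ k + 2 + 1)
    refine isKroneckerChar_of_ker_le h8 isKroneckerChar_eight χ fun u hu ↦ ?_
    rw [MonoidHom.mem_ker] at hu ⊢
    have hu1 : u.val.val % 8 = 1 := ZMod.val_modEq_one_of_unitsMap_eq_one h8 hu
    obtain ⟨x, hx⟩ := Int.exists_two_pow_dvd_sq_sub (a := u.val.val) (by omega) k
    apply MonoidHom.eq_one_of_isSquare_val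
    refine ⟨x, ?_⟩
    rw [show (2 : ℤ) ^ (k + 3) = (2 ^ (k + 2 + 1) : ℕ) by push_cast; rfl,
      ← ZMod.intCast_eq_intCast_iff_dvd_sub] at hx
    simpa [pow_two] using hx

theorem IsKroneckerChar.of_coprime {m n : ℕ} (h : m.Coprime n)
    (hm : ∀ χ : (ZMod m)ˣ →* ℤˣ, IsKroneckerChar χ)
    (hn : ∀ χ : (ZMod n)ˣ →* ℤˣ, IsKroneckerChar χ)
    (χ : (ZMod (m * n))ˣ →* ℤˣ) : IsKroneckerChar χ := by
  let e : (ZMod (m * n))ˣ ≃* (ZMod m)ˣ × (ZMod n)ˣ :=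
    (Units.mapEquiv (ZMod.chineseRemainder h).toMulEquiv).trans MulEquiv.prodUnits
  obtain ⟨D, hD, hDm, hDy⟩ := hm (χ.comp (e.symm.toMonoidHom.comp (MonoidHom.inl _ _)))
  obtain ⟨E, hE, hEn, hEy⟩ := hn (χ.comp (e.symm.toMonoidHom.comp (MonoidHom.inr _ _)))
  have hDE : IsCoprime D E :=
    (Nat.isCoprime_iff_coprime.mpr h).of_isCoprime_of_dvd_left hDm |>.of_isCoprime_of_dvd_right hEn
  refine ⟨D * E, hD.mul hE hDE, by push_cast; exact mul_dvd_mul hDm hEn, fun u y hu ↦ ?_⟩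
  have hy : ZMod.chineseRemainder h (y : ZMod (m * n)) = ((y : ZMod m), (y : ZMod n)) := by
    simp [map_natCast]; rfl
  rw [kron_mul_left, hDy (e u).1 y ?_, hEy (e u).2 y ?_, ← Units.val_mul]
  · congr 1
    simp [← map_mul]
  · change _ = (ZMod.chineseRemainder h u.val).2
    rw [← hu, hy]
  · change _ = (ZMod.chineseRemainder h u.val).1
    rw [← hu, hy]

theorem isKroneckerChar {N : ℕ} (hN : N ≠ 0) (χ : (ZMod N)ˣ →* ℤˣ) : IsKroneckerChar χ := by
  induction N using Nat.recOnPosPrimePosCoprime with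
  | zero => exact absurd rfl hN
  | one => rw [Subsingleton.elim χ 1]; exact isKroneckerChar_one
  | prime_pow p k hp hk =>
    obtain ⟨k, rfl⟩ := Nat.exists_eq_succ_of_ne_zero hk.ne'
    rcases eq_or_ne p 2 with rfl | hp2
    · exact isKroneckerChar_two_pow k χ
    · exact isKroneckerChar_odd_prime_pow hp hp2 k χ
  | coprime a b ha hb hab iha ihb =>
    exact .of_coprime hab (iha (by omega)) (ihb (by omega)) χ

theorem DirichletCharacter.eq_one_or_neg_one_of_real {N : ℕ} [NeZero N] (χ : DirichletCharacter ℂ N)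
    (u : (ZMod N)ˣ) (h : ∃ r : ℝ, χ u = r) : χ u = 1 ∨ χ u = -1 := by
  obtain ⟨r, hr⟩ := h
  have hn := DirichletCharacter.unit_norm_eq_one χ u
  rw [hr, Complex.norm_real, Real.norm_eq_abs] at hn
  rw [hr]
  rcases eq_or_eq_neg_of_abs_eq hn with rfl | rfl <;> simp

theorem DirichletCharacter.exists_kron_eq {N : ℕ} [NeZero N] (χ : DirichletCharacter ℂ N)
    (hreal : ∀ y : ZMod N, ∃ r : ℝ, χ y = r) :
    ∃ D : ℤ, IsFundamentalDiscriminant D ∧ D ∣ N ∧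
      ∀ y : ℕ, IsUnit (y : ZMod N) → χ y = kron D y := by
  have hχ (u : (ZMod N)ˣ) := DirichletCharacter.eq_one_or_neg_one_of_real χ u (hreal u)
  let ψ : (ZMod N)ˣ →* ℤˣ := MonoidHom.mk' (fun u ↦ if χ u = 1 then 1 else -1) (by
    intro u v
    rcases hχ u with hu | hu <;> rcases hχ v with hv | hv <;> simp [hu, hv, neg_one_eq_one_iff])
  obtain ⟨D, hD, hDN, hy⟩ := isKroneckerChar (NeZero.ne N) ψ
  refine ⟨D, hD, hDN, fun y ⟨u, hu⟩ ↦ ?_⟩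
  rw [hy u y hu.symm, ← hu]
  rcases hχ u with h | h <;> simp [ψ, h, neg_one_eq_one_iff]

theorem DirichletCharacter.factorsThrough_of_kron_eq {N : ℕ} [NeZero N]
    {χ : DirichletCharacter ℂ N} {D : ℤ} (hD : IsFundamentalDiscriminant D) (hDN : D ∣ N)
    (h : ∀ y : ℕ, IsUnit (y : ZMod N) → χ y = kron D y) : χ.FactorsThrough D.natAbs := by
  have hd : D.natAbs ∣ N := Int.natCast_dvd_natCast.mp (Int.natAbs_dvd.mpr hDN)
  rw [DirichletCharacter.factorsThrough_iff_ker_unitsMap hd]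
  intro u hu
  rw [MonoidHom.mem_ker] at hu ⊢
  have h1 : (u.val.val : ℤ) ≡ 1 [ZMOD D] := by
    have := ZMod.val_modEq_one_of_unitsMap_eq_one hd hu
    rwa [← Int.natCast_modEq_iff, Int.modEq_iff_dvd, Int.natAbs_dvd, ← Int.modEq_iff_dvd] at this
  have := h u.val.val (by simp)
  rw [kron_eq_one_of_modEq hD.ne_zero hD.emod_four h1] at this
  ext
  simpa using this

/-- Dirichlet's lemma: every real Dirichlet character `χ` mod `N` can
be written as `χ(y) = (d/y)` for some `d ≡ 0` or `1 (mod 4)`; moreover every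
primitive real character equals `(D/·)` for a fundamental discriminant `D` with
`|D|` equal to the conductor of `χ`. -/
theorem stmt_2 (N : ℕ) (hN : 0 < N) (χ : DirichletCharacter ℂ N)
    (hreal : ∀ y : ZMod N, ∃ r : ℝ, χ y = (r : ℂ)) :
    (∃ d : ℤ, (d % 4 = 0 ∨ d % 4 = 1) ∧ ∀ y : ℕ, χ (y : ZMod N) = (kron d y : ℂ)) ∧
    (χ.IsPrimitive → ∃ D : ℤ, IsFundamentalDiscriminant D ∧
      D.natAbs = DirichletCharacter.conductor χ ∧
      ∀ y : ℕ, χ (y : ZMod N) = (kron D y : ℂ)) := by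
  have : NeZero N := ⟨hN.ne'⟩
  obtain ⟨D, hD, hDN, h⟩ := χ.exists_kron_eq hreal
  have hunit (y : ℕ) : IsUnit (y : ZMod N) ↔ IsCoprime (N : ℤ) y := by
    rw [ZMod.isUnit_iff_coprime, Nat.isCoprime_iff_coprime, Nat.coprime_comm]
  refine ⟨⟨D * N ^ 2, ?_, fun y ↦ ?_⟩, fun hprim ↦ ⟨D, hD, ?_⟩⟩
  · rcases hD.emod_four with h4 | h4
    · left
      rw [Int.mul_emod, h4, zero_mul, Int.zero_emod]
    · rw [Int.mul_emod, h4, one_mul, Int.emod_emod]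
      rcases Int.even_or_odd (N : ℤ) with hN2 | hN2
      · left
        exact Int.emod_eq_zero_of_dvd (pow_dvd_pow_of_dvd hN2.two_dvd 2)
      · right
        exact Int.sq_mod_four_eq_one_of_odd hN2
  · by_cases hy : IsUnit (y : ZMod N)
    · have hNy := kron_sq_eq_one ((hunit y).mp hy)
      rw [h y hy, kron_mul_left, pow_two, kron_mul_left, ← pow_two, hNy, mul_one]
    · rw [χ.map_nonunit hy, kron_eq_zero, Int.cast_zero]
      rw [hunit] at hy
      exact fun hc ↦ hy ((IsCoprime.pow_left_iff two_pos).mp hc.of_mul_left_right)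
  · have hDabs : D.natAbs = N := by
      refine Nat.dvd_antisymm (Int.natCast_dvd_natCast.mp (Int.natAbs_dvd.mpr hDN)) ?_
      have := χ.conductor_dvd_of_mem_conductorSet
        (DirichletCharacter.factorsThrough_of_kron_eq hD hDN h)
      rwa [(DirichletCharacter.isPrimitive_def χ).mp hprim] at this
    refine ⟨hDabs.trans hprim.symm, fun y ↦ ?_⟩
    by_cases hy : IsUnit (y : ZMod N)
    · exact h y hy
    · rw [χ.map_nonunit hy, kron_eq_zero, Int.cast_zero]
      rw [hunit, ← hDabs] at hy
      exact fun hc ↦ hy (hc.of_isCoprime_of_dvd_left (Int.natAbs_dvd.mpr dvd_rfl))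
end

section
/- For a four-times continuously differentiable test function φ supported in [a/(2x+2T), a/(x−T)], equal to 1 on [a/(2x), a/x], with φ' ≪ x²/(aT), and for the transform φ̌(it) = cos(πt)∫₀^∞ K_{2t}(u) φ(u) du/u with t ∈ (0, 1/4], one has φ̌(it) ≪ (x/a)^{2t} + O(1), with implied constant depending only on a lower bound for t. -/
open MeasureTheory

/-- The modified Bessel function of the second kind of real order `ν`, via the
integral representation `K_ν(u) = ∫₀^∞ e^{−u·cosh w}·cosh(ν·w) dw`. -/
noncomputable def besselK (ν u : ℝ) : ℝ :=
  ∫ w in Set.Ioi (0:ℝ), Real.exp (-u * Real.cosh w) * Real.cosh (ν * w)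

open Set

theorem integral_exp_neg_mul_abs {c : ℝ} (hc : 0 < c) :
    ∫ w : ℝ, Real.exp (-c * |w|) = 2 / c := by
  rw [integral_comp_abs (f := fun w => Real.exp (-c * w)), integral_exp_mul_Ioi (by linarith)]
  simp [div_eq_mul_inv]

theorem integrable_exp_neg_mul_abs {c : ℝ} (hc : 0 < c) :
    Integrable fun w : ℝ => Real.exp (-c * |w|) := by
  refine Integrable.of_integral_ne_zero ?_
  rw [integral_exp_neg_mul_abs hc]
  positivity

theorem mul_sub_exp_le_neg_mul_abs {c : ℝ} (hc : c ≤ 1 / 2) (s : ℝ) :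
    c * s - Real.exp s ≤ -c * |s| := by
  rcases le_total 0 s with hs | hs
  · rw [abs_of_nonneg hs]
    nlinarith [Real.add_one_le_exp s]
  · rw [abs_of_nonpos hs]
    linarith [Real.exp_pos s]

theorem besselK_integrand_le {ν u w : ℝ} (hν : 0 < ν) (hν' : ν ≤ 1 / 2) (hu : 0 < u)
    (hw : 0 ≤ w) :
    Real.exp (-u * Real.cosh w) * Real.cosh (ν * w) ≤
      (2 / u) ^ ν * Real.exp (-ν * |w - Real.log (2 / u)|) := by
  have hcosh : Real.cosh (ν * w) ≤ Real.exp (ν * w) := by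
    rw [Real.cosh_eq]
    have : Real.exp (-(ν * w)) ≤ Real.exp (ν * w) :=
      Real.exp_le_exp.mpr (by nlinarith [mul_nonneg hν.le hw])
    linarith
  have hexp : Real.exp (w - Real.log (2 / u)) ≤ u * Real.cosh w := by
    rw [Real.exp_sub, Real.exp_log (by positivity), Real.cosh_eq]
    have h : Real.exp w / (2 / u) = u * (Real.exp w / 2) := by field_simp
    rw [h]
    gcongr
    linarith [Real.exp_pos (-w)]
  have hbound := mul_sub_exp_le_neg_mul_abs hν' (w - Real.log (2 / u))
  calc Real.exp (-u * Real.cosh w) * Real.cosh (ν * w)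
      ≤ Real.exp (-u * Real.cosh w) * Real.exp (ν * w) := by gcongr
    _ ≤ (2 / u) ^ ν * Real.exp (-ν * |w - Real.log (2 / u)|) := by
        rw [Real.rpow_def_of_pos (by positivity), ← Real.exp_add, ← Real.exp_add]
        exact Real.exp_le_exp.mpr (by linarith)

theorem abs_besselK_le {ν u : ℝ} (hν : 0 < ν) (hν' : ν ≤ 1 / 2) (hu : 0 < u) :
    |besselK ν u| ≤ (2 / u) ^ ν * (2 / ν) := by
  have hint : Integrable fun w : ℝ =>
      (2 / u) ^ ν * Real.exp (-ν * |w - Real.log (2 / u)|) :=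
    ((integrable_exp_neg_mul_abs hν).comp_sub_right _).const_mul _
  calc |besselK ν u|
      ≤ ∫ w in Ioi (0 : ℝ), (2 / u) ^ ν * Real.exp (-ν * |w - Real.log (2 / u)|) := by
        refine norm_integral_le_of_norm_le (G := ℝ) hint.integrableOn ?_
        refine (ae_restrict_mem measurableSet_Ioi).mono fun w hw => ?_
        rw [Real.norm_of_nonneg (mul_nonneg (Real.exp_pos _).le (Real.cosh_pos _).le)]
        exact besselK_integrand_le hν hν' hu (le_of_lt hw)
    _ ≤ ∫ w, (2 / u) ^ ν * Real.exp (-ν * |w - Real.log (2 / u)|) :=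
        setIntegral_le_integral hint (Filter.Eventually.of_forall fun w => by positivity)
    _ = (2 / u) ^ ν * (2 / ν) := by
        rw [integral_const_mul,
          integral_sub_right_eq_self (fun w => Real.exp (-ν * |w|)), integral_exp_neg_mul_abs hν]

theorem abs_integral_besselK_mul_div_le {ν A B : ℝ} {φ : ℝ → ℝ} (hν : 0 < ν) (hν' : ν ≤ 1 / 2)
    (hA : 0 < A) (hAB : A ≤ B) (hφ : ∀ u, |φ u| ≤ 1) (hsupp : ∀ u, u ∉ Icc A B → φ u = 0) :
    |∫ u in Ioi (0 : ℝ), besselK ν u * φ u / u| ≤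
      (2 / A) ^ ν * (2 / ν) / A * (B - A) := by
  rw [setIntegral_eq_of_subset_of_forall_sdiff_eq_zero measurableSet_Ioi
    (fun u hu => hA.trans_le hu.1 : Icc A B ⊆ Ioi 0) (fun u hu => by simp [hsupp u hu.2])]
  refine (norm_setIntegral_le_of_norm_le_const (E := ℝ) measure_Icc_lt_top fun u hu => ?_).trans_eq
    (by rw [Real.volume_real_Icc_of_le hAB])
  have hu0 : 0 < u := hA.trans_le hu.1
  rw [Real.norm_eq_abs, abs_div, abs_mul, abs_of_pos hu0]
  have hK : |besselK ν u| * |φ u| ≤ (2 / A) ^ ν * (2 / ν) :=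
    calc |besselK ν u| * |φ u| ≤ |besselK ν u| :=
          mul_le_of_le_one_right (abs_nonneg _) (hφ u)
      _ ≤ (2 / u) ^ ν * (2 / ν) := abs_besselK_le hν hν' hu0
      _ ≤ (2 / A) ^ ν * (2 / ν) := by
          have := hu.1
          gcongr
  exact div_le_div₀ (by positivity) hK hA hu.1

/-- for the test function `φ` (C⁴, supported in
`[a/(2x+2T), a/(x−T)]`, equal to `1` on `[a/(2x), a/x]`, with `φ' ≪ x²/(aT)`,
taking values in `[0,1]`) and `t ∈ (0, 1/4]` bounded below by `t₀`,
the transform `φ̌(it) = cos(πt)·∫₀^∞ K_{2t}(u)·φ(u)·du/u` satisfies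
`φ̌(it) ≪ (x/a)^{2t} + O(1)`, the implied constant depending only on `t₀` (and the
constant `C₁` in the derivative bound). -/
theorem stmt_10 (t₀ C₁ : ℝ) (ht₀ : 0 < t₀) (hC₁ : 0 < C₁) :
    ∃ C : ℝ, 0 < C ∧ ∀ (a x T t : ℝ) (φ : ℝ → ℝ),
      0 < a → 0 < T → T ≤ x / 3 →
      t₀ ≤ t → t ≤ 1/4 →
      ContDiff ℝ 4 φ →
      (∀ u : ℝ, u ∉ Set.Icc (a/(2*x+2*T)) (a/(x-T)) → φ u = 0) →
      (∀ u ∈ Set.Icc (a/(2*x)) (a/x), φ u = 1) →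
      (∀ u : ℝ, |deriv φ u| ≤ C₁ * x^2 / (a*T)) →
      (∀ u : ℝ, 0 ≤ φ u ∧ φ u ≤ 1) →
      |Real.cos (Real.pi * t) * ∫ u in Set.Ioi (0:ℝ), besselK (2*t) u * φ u / u| ≤
        C * ((x/a) ^ (2*t) + 1) := by
  refine ⟨18 / t₀, by positivity, fun a x T t φ ha hT hTx ht ht' _ hsupp _ _ hφ => ?_⟩
  have hx : 0 < x := by linarith
  have hxT : 0 < x - T := by linarith
  have ht0 : 0 < t := ht₀.trans_le ht
  set A := a / (2 * x + 2 * T) with hA_def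
  set B := a / (x - T) with hB_def
  have hA : 0 < A := by positivity
  have hAB : A ≤ B := div_le_div_of_nonneg_left ha.le hxT (by linarith)
  have hB4 : B ≤ 4 * A := by
    rw [hA_def, hB_def, ← mul_div_assoc, div_le_div_iff₀ hxT (by positivity)]
    nlinarith
  have hlen : (B - A) / A ≤ 3 := by
    rw [div_le_iff₀ hA]
    linarith
  have hpow : (2 / A) ^ (2 * t) ≤ 6 * (x / a) ^ (2 * t) :=
    calc (2 / A) ^ (2 * t) ≤ (6 * (x / a)) ^ (2 * t) := by
          refine Real.rpow_le_rpow (by positivity) ?_ (by positivity)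
          rw [hA_def, div_div_eq_mul_div, ← mul_div_assoc]
          exact div_le_div_of_nonneg_right (by linarith) ha.le
      _ = 6 ^ (2 * t) * (x / a) ^ (2 * t) := Real.mul_rpow (by norm_num) (by positivity)
      _ ≤ 6 * (x / a) ^ (2 * t) := by
          gcongr
          exact Real.rpow_le_self_of_one_le (by norm_num) (by linarith)
  have hmain := abs_integral_besselK_mul_div_le (ν := 2 * t) (by positivity) (by linarith) hA hAB
    (fun u => by rw [abs_of_nonneg (hφ u).1]; exact (hφ u).2) hsupp
  have hν : 2 / (2 * t) ≤ 1 / t₀ := by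
    rw [div_mul_cancel_left₀ two_ne_zero, ← one_div]
    gcongr
  rw [abs_mul]
  calc |Real.cos (Real.pi * t)| * |∫ u in Ioi (0 : ℝ), besselK (2 * t) u * φ u / u|
      ≤ |∫ u in Ioi (0 : ℝ), besselK (2 * t) u * φ u / u| :=
        mul_le_of_le_one_left (abs_nonneg _) (Real.abs_cos_le_one _)
    _ ≤ (2 / A) ^ (2 * t) * (2 / (2 * t)) / A * (B - A) := hmain
    _ = (2 / A) ^ (2 * t) * (2 / (2 * t)) * ((B - A) / A) := by ring
    _ ≤ 6 * (x / a) ^ (2 * t) * (1 / t₀) * 3 := by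
        have := sub_nonneg.mpr hAB
        gcongr
    _ = 18 / t₀ * (x / a) ^ (2 * t) := by ring
    _ ≤ 18 / t₀ * ((x / a) ^ (2 * t) + 1) := by
        gcongr
        linarith
end
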